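/- Let 0 < p ≤ 1. Let X and Y be complex Banach spaces, A0 : X → Y boundedly invertible with ‖A0⁻¹‖ ≤ 1/μ0 for some μ0 > 0, and (Aj)_{j≥1} bounded linear operators from X to Y with β_{0,j} = ‖A0⁻¹ ∘ Aj‖. Let v = (v_j)_{j≥1} be a weight sequence with v_j ≥ 1 such that ∑_{j≥1} β_{0,j} v_j^{(2-p)/p} ≤ κ for some κ < 1 and ∑_{j≥1} β_{0,j}^p v_j^{2-p} < ∞. Fix f ∈ Y, for y ∈ U = [-1,1]^ℕ let u(y) = (A0 + ∑_{j≥1} y_j Aj)⁻¹ f, and let d_ν = ∫_U u(y) T_ν(y) dη(y) ∈ X for ν ∈ F be the tensorized Chebyshev coefficients (Bochner integrals against the product Chebyshev measure η). For θ ≥ 1 define weights ω_ν = θ^{‖ν‖₀} ∏_{j ∈ supp ν} v_j^{ν_j}. Then ∑_{ν ∈ F} ω_ν^{2-p} ‖d_ν‖_X^p < ∞. -/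

import Mathlib

open MeasureTheory

/-- The L²-normalized Chebyshev polynomials: `T 0 = 1`, `T n t = √2 cos (n arccos t)`. -/
noncomputable def chebFun (n : ℕ) (t : ℝ) : ℝ :=
  if n = 0 then 1 else Real.sqrt 2 * Real.cos (n * Real.arccos t)

/-- The Chebyshev (arcsine) probability measure `dσ(t) = dt/(π √(1-t²))` on `(-1,1)`. -/
noncomputable def chebMeasure : Measure ℝ :=
  (volume.restrict (Set.Ioo (-1 : ℝ) 1)).withDensity
    (fun t => ENNReal.ofReal (1 / (Real.pi * Real.sqrt (1 - t ^ 2))))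

/-- `η` is the countable product of the Chebyshev measures. -/
def IsChebProductMeasure (η : Measure (ℕ → ℝ)) : Prop :=
  IsProbabilityMeasure η ∧
    ∀ (s : Finset ℕ) (B : ℕ → Set ℝ), (∀ i, MeasurableSet (B i)) →
      η {y | ∀ i ∈ s, y i ∈ B i} = ∏ i ∈ s, chebMeasure (B i)

/-- The tensorized Chebyshev polynomial `T_ν(y) = ∏_{j ∈ supp ν} T_{ν_j}(y_j)`. -/
noncomputable def chebProd (ν : ℕ →₀ ℕ) (y : ℕ → ℝ) : ℝ :=
  ∏ j ∈ ν.support, chebFun (ν j) (y j)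

/-- Products of geometric series: a multi-index power series with summable ratios below `1`
is summable. -/
theorem summable_finsupp_prod_pow {ι : Type*} (ε : ι → ℝ) (h0 : ∀ j, 0 ≤ ε j)
    (h1 : ∀ j, ε j < 1) (hs : Summable ε) :
    Summable fun ν : ι →₀ ℕ => ∏ j ∈ ν.support, ε j ^ ν j := by
  classical
  have hs' : Summable fun j => (1 - ε j)⁻¹ - 1 := by
    refine Summable.of_norm_bounded_eventually (hs.mul_left 2) ?_
    filter_upwards [hs.tendsto_cofinite_zero.eventually (gt_mem_nhds (show (0 : ℝ) < 1 / 2 by norm_num))]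
      with j hj
    have hpos : 0 < 1 - ε j := by linarith
    have : (1 - ε j)⁻¹ - 1 = ε j / (1 - ε j) := by field_simp; ring
    rw [this, Real.norm_of_nonneg (div_nonneg (h0 j) hpos.le), div_le_iff₀ hpos]
    nlinarith [h0 j]
  have hn : ∀ j, 0 ≤ (1 - ε j)⁻¹ - 1 := fun j => by
    have := (one_le_inv₀ (sub_pos.2 (h1 j))).2 (by linarith [h0 j])
    linarith
  refine summable_of_sum_le (c := Real.exp (∑' j, ((1 - ε j)⁻¹ - 1)))
    (fun ν => Finset.prod_nonneg fun j _ => pow_nonneg (h0 j) _) fun T => ?_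
  set s : Finset ι := T.biUnion Finsupp.support with hsdef
  set N : ℕ := T.sup fun ν => ν.support.sup ν with hN
  have hsub : T ⊆ s.finsupp fun _ => Finset.range (N + 1) := by
    intro ν hν
    rw [Finset.mem_finsupp_iff]
    refine ⟨Finset.subset_biUnion_of_mem Finsupp.support hν, fun i _ => ?_⟩
    rw [Finset.mem_range, Nat.lt_succ_iff]
    by_cases hi : i ∈ ν.support
    · exact (Finset.le_sup (f := ν) hi).trans
        (Finset.le_sup (f := fun ν : ι →₀ ℕ => ν.support.sup ν) hν)
    · rw [Finsupp.notMem_support_iff.1 hi]; exact Nat.zero_le _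
  calc ∑ ν ∈ T, ∏ j ∈ ν.support, ε j ^ ν j
      ≤ ∑ ν ∈ s.finsupp fun _ => Finset.range (N + 1), ∏ j ∈ ν.support, ε j ^ ν j :=
        Finset.sum_le_sum_of_subset_of_nonneg hsub fun ν _ _ =>
          Finset.prod_nonneg fun j _ => pow_nonneg (h0 j) _
    _ = ∑ ν ∈ s.finsupp fun _ => Finset.range (N + 1), ∏ j ∈ s, ε j ^ ν j := by
        refine Finset.sum_congr rfl fun ν hν => ?_
        refine Finset.prod_subset (Finset.mem_finsupp_iff.1 hν).1 fun j _ hj => ?_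
        rw [Finsupp.notMem_support_iff.1 hj, pow_zero]
    _ = ∏ j ∈ s, ∑ n ∈ Finset.range (N + 1), ε j ^ n := by
        rw [Finset.prod_sum, Finset.finsupp, Finset.sum_map]
        refine Finset.sum_congr rfl fun q _ => ?_
        rw [← Finset.prod_attach s]
        refine Finset.prod_congr rfl fun j _ => ?_
        simp
    _ ≤ ∏ j ∈ s, Real.exp ((1 - ε j)⁻¹ - 1) := by
        refine Finset.prod_le_prod (fun j _ => Finset.sum_nonneg fun n _ => pow_nonneg (h0 j) _)
          fun j _ => ?_
        refine le_trans ?_ (Real.add_one_le_exp _)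
        rw [sub_add_cancel, ← tsum_geometric_of_lt_one (h0 j) (h1 j)]
        exact (summable_geometric_of_lt_one (h0 j) (h1 j)).sum_le_tsum _
          fun n _ => pow_nonneg (h0 j) _
    _ = Real.exp (∑ j ∈ s, ((1 - ε j)⁻¹ - 1)) := (Real.exp_sum _ _).symm
    _ ≤ _ := Real.exp_le_exp.2 (hs'.sum_le_tsum _ fun j _ => hn j)

/-- A bounded subsolution of a contractive shift recursion inherits weighted `ℓ¹` bounds. -/
theorem tsum_weight_mul_le_of_shift_recursion {Z : Type*} [AddCommGroup Z] [DecidableEq Z]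
    (e : ℕ → Z) (D R : Z → ENNReal) (M G C β κ : ENNReal) (b r : ℕ → ENNReal)
    (hM : M ≠ ⊤) (hD : ∀ z, D z ≤ M) (hR : ∀ z, R z ≠ ⊤)
    (hrec : ∀ z, D z ≤ (if z = 0 then G else 0) + ∑' j, b j * (D (z + e j) + D (z - e j)))
    (hβ : ∑' j, b j * 2 ≤ β) (hβ1 : β < 1)
    (hRadd : ∀ z j, R z ≤ r j * R (z + e j)) (hRsub : ∀ z j, R z ≤ r j * R (z - e j))
    (hκ : ∑' j, b j * r j * 2 ≤ κ) (hC : R 0 * G + κ * C ≤ C) :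
    ∑' z, R z * D z ≤ C := by
  let S : ℕ → Z → ENNReal := fun n => Nat.rec (fun _ => 0)
    (fun _ h z => (if z = 0 then G else 0) + ∑' j, b j * (h (z + e j) + h (z - e j))) n
  have hS : ∀ n z, S (n + 1) z =
      (if z = 0 then G else 0) + ∑' j, b j * (S n (z + e j) + S n (z - e j)) := fun n z => rfl
  have h1 : ∀ n z, D z ≤ S n z + β ^ n * M := by
    intro n
    induction n with
    | zero => intro z; simpa [S] using hD z
    | succ n ih =>
      intro z
      calc D z ≤ (if z = 0 then G else 0) + ∑' j, b j * (D (z + e j) + D (z - e j)) := hrec z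
        _ ≤ (if z = 0 then G else 0) + ∑' j, (b j * (S n (z + e j) + S n (z - e j)) +
              b j * 2 * (β ^ n * M)) := by
            gcongr with j
            calc b j * (D (z + e j) + D (z - e j))
                ≤ b j * ((S n (z + e j) + β ^ n * M) + (S n (z - e j) + β ^ n * M)) := by
                  gcongr <;> apply ih
              _ = _ := by ring
        _ = S (n + 1) z + (∑' j, b j * 2) * (β ^ n * M) := by
            rw [ENNReal.tsum_add, ENNReal.tsum_mul_right, hS, add_assoc]
        _ ≤ S (n + 1) z + β * (β ^ n * M) := by gcongr
        _ = _ := by rw [pow_succ]; ring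
  have h2 : ∀ n, ∑' z, R z * S n z ≤ C := by
    intro n
    induction n with
    | zero => simp [S]
    | succ n ih =>
      have hshift : ∀ j, ∑' z, R z * (b j * (S n (z + e j) + S n (z - e j))) ≤
          b j * r j * 2 * C := by
        intro j
        calc ∑' z, R z * (b j * (S n (z + e j) + S n (z - e j)))
            ≤ ∑' z, (b j * r j * (R (z + e j) * S n (z + e j)) +
                b j * r j * (R (z - e j) * S n (z - e j))) := by
              refine ENNReal.tsum_le_tsum fun z => ?_
              calc R z * (b j * (S n (z + e j) + S n (z - e j)))
                  = b j * S n (z + e j) * R z + b j * S n (z - e j) * R z := by ring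
                _ ≤ b j * S n (z + e j) * (r j * R (z + e j)) +
                    b j * S n (z - e j) * (r j * R (z - e j)) := by
                  gcongr
                  · exact hRadd z j
                  · exact hRsub z j
                _ = _ := by ring
          _ = b j * r j * (∑' z, R z * S n z) + b j * r j * (∑' z, R z * S n z) := by
              rw [ENNReal.tsum_add, ENNReal.tsum_mul_left, ENNReal.tsum_mul_left]
              congr 2
              · exact (Equiv.addRight (e j)).tsum_eq fun z => R z * S n z
              · exact (Equiv.subRight (e j)).tsum_eq fun z => R z * S n z
          _ ≤ b j * r j * C + b j * r j * C := by gcongr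
          _ = _ := by ring
      calc ∑' z, R z * S (n + 1) z
          = ∑' z, (R z * (if z = 0 then G else 0) +
              ∑' j, R z * (b j * (S n (z + e j) + S n (z - e j)))) := by
            refine tsum_congr fun z => ?_
            rw [hS, mul_add, ← ENNReal.tsum_mul_left]
        _ = R 0 * G + ∑' j, ∑' z, R z * (b j * (S n (z + e j) + S n (z - e j))) := by
            rw [ENNReal.tsum_add, ENNReal.tsum_comm, tsum_eq_single 0]
            · simp
            · intro z hz; simp [hz]
        _ ≤ R 0 * G + ∑' j, b j * r j * 2 * C := by
            gcongr with j
            exact hshift j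
        _ = R 0 * G + (∑' j, b j * r j * 2) * C := by rw [ENNReal.tsum_mul_right]
        _ ≤ R 0 * G + κ * C := by gcongr
        _ ≤ C := hC
  rw [ENNReal.tsum_eq_iSup_sum]
  refine iSup_le fun F => ?_
  have hlim : Filter.Tendsto (fun n : ℕ => C + β ^ n * (M * ∑ z ∈ F, R z)) Filter.atTop
      (nhds (C + 0 * (M * ∑ z ∈ F, R z))) := by
    refine Filter.Tendsto.const_add _ (ENNReal.Tendsto.mul_const
      (ENNReal.tendsto_pow_atTop_nhds_zero_of_lt_one hβ1) (Or.inr ?_))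
    exact ENNReal.mul_ne_top hM (ENNReal.sum_ne_top.2 fun z _ => hR z)
  rw [zero_mul, add_zero] at hlim
  refine ge_of_tendsto' hlim fun n => ?_
  calc ∑ z ∈ F, R z * D z ≤ ∑ z ∈ F, (R z * S n z + R z * (β ^ n * M)) := by
        gcongr with z
        rw [← mul_add]
        gcongr
        exact h1 n z
    _ = ∑ z ∈ F, R z * S n z + β ^ n * (M * ∑ z ∈ F, R z) := by
        rw [Finset.sum_add_distrib, ← Finset.sum_mul]; ring
    _ ≤ C + β ^ n * (M * ∑ z ∈ F, R z) := by
        gcongr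
        exact (ENNReal.sum_le_tsum F).trans (h2 n)

theorem Finsupp.prod_add_single_eq {ι A M : Type*} [AddGroup A] [CommMonoid M]
    (z : ι →₀ A) (j : ι) (n : A) (h : ι → A → M) (h0 : ∀ i, h i 0 = 1) :
    (z + Finsupp.single j n).prod h = h j (z j + n) * (z.erase j).prod h := by
  rw [← Finsupp.mul_prod_erase' _ j h h0, Finsupp.erase_add, Finsupp.erase_single]
  simp

/-- Weighted summability of a bounded subsolution of a nearest-neighbour recursion on the lattice
of finitely supported integer sequences. -/
theorem summable_weight_mul_of_lattice_recursion (D : (ℕ →₀ ℤ) → ℝ) (M G : ℝ) (b r : ℕ → ℝ)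
    (hD0 : ∀ z, 0 ≤ D z) (hDM : ∀ z, D z ≤ M) (hG : 0 ≤ G) (hb : ∀ j, 0 ≤ b j)
    (hr : ∀ j, 1 ≤ r j) (hs : Summable fun j => b j * r j) (hlt : ∑' j, b j * r j < 1)
    (hrec : ∀ z, D z ≤ (if z = 0 then G else 0) +
      ∑' j, b j / 2 * (D (z + Finsupp.single j 1) + D (z - Finsupp.single j 1))) :
    Summable fun z : ℕ →₀ ℤ => (z.prod fun j n => r j ^ n.natAbs) * D z := by
  have hr0 : ∀ j, 0 ≤ r j := fun j => zero_le_one.trans (hr j)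
  have hM : 0 ≤ M := (hD0 0).trans (hDM 0)
  have hbs : Summable b := hs.of_nonneg_of_le hb fun j => le_mul_of_one_le_right (hb j) (hr j)
  have hW0 : ∀ z : ℕ →₀ ℤ, 0 ≤ z.prod fun j n => r j ^ n.natAbs := fun z =>
    Finset.prod_nonneg fun j _ => pow_nonneg (hr0 j) _
  have hstep : ∀ (z : ℕ →₀ ℤ) (j : ℕ) (n : ℤ), n.natAbs = 1 →
      (z.prod fun j n => r j ^ n.natAbs) ≤
        r j * (z + Finsupp.single j n).prod fun j n => r j ^ n.natAbs := by
    intro z j n hn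
    have h1 := Finsupp.prod_add_single_eq z j 0 (fun j (n : ℤ) => r j ^ n.natAbs) (by simp)
    rw [Finsupp.single_zero, add_zero, add_zero] at h1
    rw [h1, Finsupp.prod_add_single_eq z j n (fun j (n : ℤ) => r j ^ n.natAbs) (by simp),
      ← mul_assoc, ← pow_succ']
    exact mul_le_mul_of_nonneg_right (pow_le_pow_right₀ (hr j) (by omega)) (hW0 _)
  set κ := ∑' j, b j * r j with hκ
  have hκ0 : 0 ≤ κ := tsum_nonneg fun j => mul_nonneg (hb j) (hr0 j)
  have key := tsum_weight_mul_le_of_shift_recursion (Z := ℕ →₀ ℤ) (fun j => Finsupp.single j 1)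
    (fun z => ENNReal.ofReal (D z))
    (fun z => ENNReal.ofReal (z.prod fun j n => r j ^ n.natAbs)) (ENNReal.ofReal M)
    (ENNReal.ofReal G) (ENNReal.ofReal (G / (1 - κ))) (ENNReal.ofReal κ) (ENNReal.ofReal κ)
    (fun j => ENNReal.ofReal (b j / 2)) (fun j => ENNReal.ofReal (r j)) ENNReal.ofReal_ne_top
    (fun z => ENNReal.ofReal_le_ofReal (hDM z)) (fun z => ENNReal.ofReal_ne_top) ?_ ?_ ?_ ?_ ?_ ?_ ?_
  · have hfin : ∑' z : ℕ →₀ ℤ,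
        ENNReal.ofReal ((z.prod fun j n => r j ^ n.natAbs) * D z) ≠ ⊤ := by
      refine ne_top_of_le_ne_top ENNReal.ofReal_ne_top (le_trans (le_of_eq ?_) key)
      exact tsum_congr fun z => ENNReal.ofReal_mul (hW0 z)
    have := ENNReal.summable_toReal hfin
    refine this.congr fun z => ?_
    exact (ENNReal.toReal_ofReal (mul_nonneg (hW0 z) (hD0 z)))
  · intro z
    have hsum : Summable fun j =>
        b j / 2 * (D (z + Finsupp.single j 1) + D (z - Finsupp.single j 1)) := by
      refine (hbs.mul_right M).of_nonneg_of_le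
        (fun j => mul_nonneg (div_nonneg (hb j) two_pos.le) (add_nonneg (hD0 _) (hD0 _)))
        fun j => ?_
      have := hDM (z + Finsupp.single j 1)
      have := hDM (z - Finsupp.single j 1)
      nlinarith [hb j]
    refine (ENNReal.ofReal_le_ofReal (hrec z)).trans ?_
    refine ENNReal.ofReal_add_le.trans (add_le_add (le_of_eq ?_) (le_of_eq ?_))
    · split_ifs <;> simp
    · rw [ENNReal.ofReal_tsum_of_nonneg
        (fun j => mul_nonneg (div_nonneg (hb j) two_pos.le) (add_nonneg (hD0 _) (hD0 _))) hsum]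
      refine tsum_congr fun j => ?_
      rw [ENNReal.ofReal_mul (div_nonneg (hb j) two_pos.le), ENNReal.ofReal_add (hD0 _) (hD0 _)]
  · have : ∀ j, ENNReal.ofReal (b j / 2) * 2 = ENNReal.ofReal (b j) := fun j => by
      rw [← ENNReal.ofReal_ofNat 2, ← ENNReal.ofReal_mul (div_nonneg (hb j) two_pos.le)]
      congr 1; ring
    simp only [this]
    rw [← ENNReal.ofReal_tsum_of_nonneg hb hbs]
    exact ENNReal.ofReal_le_ofReal
      (hbs.tsum_le_tsum (fun j => le_mul_of_one_le_right (hb j) (hr j)) hs)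
  · exact ENNReal.ofReal_lt_one.2 hlt
  · intro z j
    rw [← ENNReal.ofReal_mul (hr0 j)]
    exact ENNReal.ofReal_le_ofReal (hstep z j 1 rfl)
  · intro z j
    rw [← ENNReal.ofReal_mul (hr0 j), sub_eq_add_neg, ← Finsupp.single_neg]
    exact ENNReal.ofReal_le_ofReal (hstep z j (-1) rfl)
  · have : ∀ j, ENNReal.ofReal (b j / 2) * ENNReal.ofReal (r j) * 2 =
        ENNReal.ofReal (b j * r j) := fun j => by
      rw [← ENNReal.ofReal_mul (div_nonneg (hb j) two_pos.le), ← ENNReal.ofReal_ofNat 2,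
        ← ENNReal.ofReal_mul (mul_nonneg (div_nonneg (hb j) two_pos.le) (hr0 j))]
      congr 1; ring
    simp only [this]
    rw [← ENNReal.ofReal_tsum_of_nonneg (fun j => mul_nonneg (hb j) (hr0 j)) hs]
  · have h1 : 0 < 1 - κ := by linarith
    rw [Finsupp.prod_zero_index, ENNReal.ofReal_one, one_mul,
      ← ENNReal.ofReal_mul hκ0, ← ENNReal.ofReal_add hG (mul_nonneg hκ0 (div_nonneg hG h1.le))]
    refine ENNReal.ofReal_le_ofReal (le_of_eq ?_)
    field_simp
    ring

/-- Splitting of an `ℓᵖ` weight into an `ℓ¹` weight and a summable geometric factor. -/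
theorem exists_weight_splitting (p : ℝ) (hp0 : 0 < p) (hp1 : p ≤ 1) (b V : ℕ → ℝ) (K : ℝ)
    (hb : ∀ j, 0 ≤ b j) (hV : ∀ j, 1 ≤ V j) (hK : 1 ≤ K)
    (hs : Summable fun j => b j * V j) (hlt : ∑' j, b j * V j < 1)
    (hsp : Summable fun j => (b j * V j) ^ p) :
    ∃ (J : Finset ℕ) (r ε : ℕ → ℝ), (∀ j, 1 ≤ r j) ∧ (Summable fun j => b j * r j) ∧
      ∑' j, b j * r j < 1 ∧ (∀ j, 0 < ε j) ∧ (∀ j, ε j < 1) ∧ Summable ε ∧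
      ∀ j, (if j ∈ J then 1 else K) * V j ≤ r j * ε j ^ ((1 - p) / p) := by
  set a : ℕ → ℝ := fun j => b j * V j with ha
  have hV0 : ∀ j, 0 < V j := fun j => zero_lt_one.trans_le (hV j)
  have hK0 : 0 < K := zero_lt_one.trans_le hK
  have ha0 : ∀ j, 0 ≤ a j := fun j => mul_nonneg (hb j) (hV0 j).le
  set σ := ∑' j, a j with hσ
  have hσ0 : 0 ≤ σ := tsum_nonneg ha0
  set t : ℝ := 2 / (1 + σ) with ht
  have ht1 : 1 < t := by rw [ht, lt_div_iff₀ (by linarith)]; linarith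
  have ht0 : 0 < t := by linarith
  have htσ : t * σ < 1 := by rw [ht, div_mul_eq_mul_div, div_lt_one (by linarith)]; linarith
  set s : ℝ := (1 - p) / p with hsdef
  have hs0 : 0 ≤ s := div_nonneg (by linarith) hp0.le
  set δ : ℕ → ℝ := fun j => a j ^ p + (1 / 2) ^ j with hδ
  have hδ0 : ∀ j, 0 < δ j := fun j =>
    add_pos_of_nonneg_of_pos (Real.rpow_nonneg (ha0 j) p) (by positivity)
  have hδs : Summable δ := hsp.add summable_geometric_two
  have haδ : ∀ j, a j * δ j ^ (-s) ≤ δ j := by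
    intro j
    have h1 : a j ≤ δ j ^ (1 / p) := by
      calc a j = (a j ^ p) ^ (1 / p) := by
            rw [← Real.rpow_mul (ha0 j), mul_one_div_cancel hp0.ne', Real.rpow_one]
        _ ≤ _ := Real.rpow_le_rpow (Real.rpow_nonneg (ha0 j) p)
            (le_add_of_nonneg_right (by positivity)) (by positivity)
    calc a j * δ j ^ (-s) ≤ δ j ^ (1 / p) * δ j ^ (-s) := by
          gcongr; exact Real.rpow_nonneg (hδ0 j).le _
      _ = δ j ^ (1 : ℝ) := by
          rw [← Real.rpow_add (hδ0 j)]
          congr 1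
          rw [hsdef]
          field_simp
          ring
      _ = δ j := Real.rpow_one _
  have htail := tendsto_tsum_compl_atTop_zero fun j => K * δ j
  obtain ⟨J, hJ⟩ := (htail.eventually (gt_mem_nhds (show (0 : ℝ) < 1 - t * σ by linarith))).exists
  have hKδs : Summable fun j => K * δ j := hδs.mul_left K
  have hKδ0 : ∀ j, 0 ≤ K * δ j := fun j => mul_nonneg hK0.le (hδ0 j).le
  have hδ1 : ∀ j, j ∉ J → δ j < 1 := by
    intro j hj
    have h1 : K * δ j ≤ ∑' i : { x // x ∉ J }, K * δ i :=
      (hKδs.subtype _).le_tsum (⟨j, hj⟩ : { x // x ∉ J }) fun i _ => hKδ0 i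
    have h2 : δ j ≤ K * δ j := le_mul_of_one_le_left (hδ0 j).le hK
    have h3 : 0 ≤ t * σ := mul_nonneg ht0.le hσ0
    linarith
  have hind : Summable ((J : Set ℕ)ᶜ.indicator fun j => K * δ j) := hKδs.indicator _
  have hindsum : ∑' j, (J : Set ℕ)ᶜ.indicator (fun j => K * δ j) j < 1 - t * σ := by
    rw [← tsum_subtype]; exact hJ
  set r : ℕ → ℝ := fun j => if j ∈ J then t * V j else K * V j * δ j ^ (-s) with hr
  have hbr : ∀ j, b j * r j ≤ t * a j + (J : Set ℕ)ᶜ.indicator (fun j => K * δ j) j := by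
    intro j
    by_cases hj : j ∈ J
    · simp only [hr, ha, hj, if_true]
      rw [Set.indicator_of_notMem (by simpa using hj)]
      apply le_of_eq; ring
    · simp only [hr, hj, if_false]
      rw [Set.indicator_of_mem (by simpa using hj)]
      have := mul_le_mul_of_nonneg_left (haδ j) hK0.le
      have h2 := mul_nonneg ht0.le (ha0 j)
      calc b j * (K * V j * δ j ^ (-s)) = K * (a j * δ j ^ (-s)) := by simp only [ha]; ring
        _ ≤ _ := by linarith
  have hr1 : ∀ j, 1 ≤ r j := by
    intro j
    by_cases hj : j ∈ J
    · simp only [hr, hj, if_true]; nlinarith [hV j]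
    · simp only [hr, hj, if_false]
      have := Real.one_le_rpow_of_pos_of_le_one_of_nonpos (hδ0 j) (hδ1 j hj).le
        (neg_nonpos.2 hs0)
      exact one_le_mul_of_one_le_of_one_le (one_le_mul_of_one_le_of_one_le hK (hV j)) this
  have hmaj : Summable fun j => t * a j + (J : Set ℕ)ᶜ.indicator (fun j => K * δ j) j :=
    (hs.mul_left t).add hind
  have hbrs : Summable fun j => b j * r j :=
    hmaj.of_nonneg_of_le (fun j => mul_nonneg (hb j) (zero_le_one.trans (hr1 j))) hbr
  refine ⟨J, r, fun j => if j ∈ J then t ^ (-p) else δ j, hr1, hbrs, ?_, ?_, ?_, ?_, ?_⟩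
  · calc ∑' j, b j * r j ≤ _ := hbrs.tsum_le_tsum hbr hmaj
      _ = t * σ + ∑' j, (J : Set ℕ)ᶜ.indicator (fun j => K * δ j) j := by
        rw [(hs.mul_left t).tsum_add hind, tsum_mul_left]
      _ < 1 := by linarith
  · intro j
    dsimp only
    split_ifs
    · exact Real.rpow_pos_of_pos ht0 _
    · exact hδ0 j
  · intro j
    dsimp only
    split_ifs with hj
    · exact Real.rpow_lt_one_of_one_lt_of_neg ht1 (by linarith)
    · exact hδ1 j hj
  · refine hδs.of_norm_bounded_eventually ?_
    filter_upwards [J.finite_toSet.compl_mem_cofinite] with j hj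
    have hj' : j ∉ J := by simpa using hj
    simp only [hj', if_false]
    rw [Real.norm_of_nonneg (hδ0 j).le]
  · intro j
    by_cases hj : j ∈ J
    · simp only [hr, hj, if_true, one_mul]
      rw [← Real.rpow_mul ht0.le, mul_right_comm]
      refine le_mul_of_one_le_left (hV0 j).le ?_
      calc (1 : ℝ) ≤ t ^ p := Real.one_le_rpow ht1.le hp0.le
        _ = t * t ^ (-p * s) := by
          rw [← Real.rpow_one_add' ht0.le]
          · congr 1; rw [hsdef]; field_simp; ring
          · rw [hsdef, show 1 + -p * ((1 - p) / p) = p by field_simp; ring]; exact hp0.ne'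
    · simp only [hr, hj, if_false]
      rw [mul_assoc, ← Real.rpow_add (hδ0 j), neg_add_cancel, Real.rpow_zero, mul_one]

/-- `ℓᵖ` summability follows from weighted `ℓ¹` summability for all admissible weights. -/
theorem summable_rpow_of_forall_weight (p : ℝ) (hp0 : 0 < p) (hp1 : p ≤ 1) (b V : ℕ → ℝ) (K : ℝ)
    (hb : ∀ j, 0 ≤ b j) (hV : ∀ j, 1 ≤ V j) (hK : 1 ≤ K)
    (hs : Summable fun j => b j * V j) (hlt : ∑' j, b j * V j < 1)
    (hsp : Summable fun j => (b j * V j) ^ p) (d : (ℕ →₀ ℕ) → ℝ) (hd : ∀ ν, 0 ≤ d ν)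
    (h : ∀ r : ℕ → ℝ, (∀ j, 1 ≤ r j) → (Summable fun j => b j * r j) → ∑' j, b j * r j < 1 →
      Summable fun ν : ℕ →₀ ℕ => (∏ j ∈ ν.support, r j ^ ν j) * d ν) :
    Summable fun ν : ℕ →₀ ℕ =>
      (K ^ ν.support.card * (∏ j ∈ ν.support, V j ^ ν j) * d ν) ^ p := by
  obtain ⟨J, r, ε, hr1, hbr, hbr1, hε0, hε1, hεs, hsplit⟩ :=
    exists_weight_splitting p hp0 hp1 b V K hb hV hK hs hlt hsp
  have hV0 : ∀ j, 0 < V j := fun j => zero_lt_one.trans_le (hV j)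
  have hr0 : ∀ j, 0 < r j := fun j => zero_lt_one.trans_le (hr1 j)
  have hK0 : 0 < K := zero_lt_one.trans_le hK
  have h1 := h r hr1 hbr hbr1
  have h2 := summable_finsupp_prod_pow ε (fun j => (hε0 j).le) hε1 hεs
  have hE0 : ∀ ν : ℕ →₀ ℕ, 0 ≤ ∏ j ∈ ν.support, ε j ^ ν j := fun ν =>
    Finset.prod_nonneg fun j _ => pow_nonneg (hε0 j).le _
  have hR0 : ∀ ν : ℕ →₀ ℕ, 0 ≤ ∏ j ∈ ν.support, r j ^ ν j := fun ν =>
    Finset.prod_nonneg fun j _ => pow_nonneg (hr0 j).le _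
  have hW0 : ∀ ν : ℕ →₀ ℕ, 0 ≤ ∏ j ∈ ν.support, V j ^ ν j := fun ν =>
    Finset.prod_nonneg fun j _ => pow_nonneg (hV0 j).le _
  set s : ℝ := (1 - p) / p with hsdef
  have hcoord : ∀ j n, n ≠ 0 →
      K * V j ^ n ≤ (if j ∈ J then K else 1) * (r j ^ n * (ε j ^ s) ^ n) := by
    intro j n hn
    rw [← mul_pow]
    have hsj := hsplit j
    by_cases hj : j ∈ J
    · simp only [hj, if_true, one_mul] at hsj ⊢
      gcongr
      exact (hV0 j).le
    · simp only [hj, if_false, one_mul] at hsj ⊢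
      refine le_trans ?_ (pow_le_pow_left₀ (mul_pos hK0 (hV0 j)).le hsj n)
      rw [mul_pow]
      exact mul_le_mul_of_nonneg_right (le_self_pow₀ hK hn) (pow_nonneg (hV0 j).le n)
  have hprod : ∀ ν : ℕ →₀ ℕ, K ^ ν.support.card * (∏ j ∈ ν.support, V j ^ ν j) ≤
      K ^ J.card * ((∏ j ∈ ν.support, r j ^ ν j) * (∏ j ∈ ν.support, ε j ^ ν j) ^ s) := by
    intro ν
    calc K ^ ν.support.card * (∏ j ∈ ν.support, V j ^ ν j)
        = ∏ j ∈ ν.support, K * V j ^ ν j := by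
          rw [Finset.prod_mul_distrib, Finset.prod_const]
      _ ≤ ∏ j ∈ ν.support, (if j ∈ J then K else 1) * (r j ^ ν j * (ε j ^ s) ^ ν j) :=
          Finset.prod_le_prod (fun j _ => mul_nonneg hK0.le (pow_nonneg (hV0 j).le _))
            fun j hj => hcoord j _ (Finsupp.mem_support_iff.1 hj)
      _ = K ^ (ν.support ∩ J).card *
            ((∏ j ∈ ν.support, r j ^ ν j) * (∏ j ∈ ν.support, ε j ^ ν j) ^ s) := by
          rw [Finset.prod_mul_distrib, Finset.prod_mul_distrib, Finset.prod_ite_mem,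
            Finset.prod_const, ← Real.finsetProd_rpow _ _ fun j _ => pow_nonneg (hε0 j).le _]
          congr 3 with j
          rw [← Real.rpow_natCast, ← Real.rpow_natCast, ← Real.rpow_mul (hε0 j).le,
            ← Real.rpow_mul (hε0 j).le, mul_comm]
      _ ≤ _ := by
          refine mul_le_mul_of_nonneg_right (pow_le_pow_right₀ hK
            (Finset.card_le_card Finset.inter_subset_right))
            (mul_nonneg (hR0 ν) (Real.rpow_nonneg (hE0 ν) _))
  refine ((h1.add h2).mul_left ((K ^ J.card) ^ p)).of_nonneg_of_le
    (fun ν => Real.rpow_nonneg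
      (mul_nonneg (mul_nonneg (pow_nonneg hK0.le _) (hW0 ν)) (hd ν)) _) fun ν => ?_
  set E := ∏ j ∈ ν.support, ε j ^ ν j
  set R := ∏ j ∈ ν.support, r j ^ ν j
  have hRd : 0 ≤ R * d ν := mul_nonneg (hR0 ν) (hd ν)
  calc (K ^ ν.support.card * (∏ j ∈ ν.support, V j ^ ν j) * d ν) ^ p
      ≤ (K ^ J.card * ((R * d ν) * E ^ s)) ^ p := by
        refine Real.rpow_le_rpow
          (mul_nonneg (mul_nonneg (pow_nonneg hK0.le _) (hW0 ν)) (hd ν)) ?_ hp0.le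
        calc _ ≤ K ^ J.card * (R * E ^ s) * d ν := mul_le_mul_of_nonneg_right (hprod ν) (hd ν)
          _ = _ := by ring
    _ = (K ^ J.card) ^ p * ((R * d ν) ^ p * E ^ (1 - p)) := by
        rw [Real.mul_rpow (pow_nonneg hK0.le _) (mul_nonneg hRd (Real.rpow_nonneg (hE0 ν) _)),
          Real.mul_rpow hRd (Real.rpow_nonneg (hE0 ν) _), ← Real.rpow_mul (hE0 ν), hsdef,
          div_mul_cancel₀ _ hp0.ne']
    _ ≤ (K ^ J.card) ^ p * (R * d ν + E) := by
        refine mul_le_mul_of_nonneg_left ?_ (Real.rpow_nonneg (pow_nonneg hK0.le _) _)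
        have := Real.geom_mean_le_arith_mean2_weighted hp0.le (sub_nonneg.2 hp1) hRd (hE0 ν)
          (by ring)
        have h3 : p * (R * d ν) ≤ R * d ν := mul_le_of_le_one_left hRd hp1
        have h4 : (1 - p) * E ≤ E := mul_le_of_le_one_left (hE0 ν) (by linarith)
        linarith

theorem IsChebProductMeasure.isProbabilityMeasure_chebMeasure {η : Measure (ℕ → ℝ)}
    (hη : IsChebProductMeasure η) : IsProbabilityMeasure chebMeasure := by
  have := hη.1
  constructor
  have h := hη.2 {0} (fun _ => Set.univ) fun _ => MeasurableSet.univ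
  simpa using h.symm

theorem IsChebProductMeasure.eq_infinitePi {η : Measure (ℕ → ℝ)} (hη : IsChebProductMeasure η)
    [IsProbabilityMeasure chebMeasure] :
    η = Measure.infinitePi fun _ : ℕ => chebMeasure :=
  Measure.eq_infinitePi _ fun s t ht => hη.2 s t ht

theorem chebMeasure_compl_Icc : chebMeasure (Set.Icc (-1 : ℝ) 1)ᶜ = 0 := by
  refine withDensity_absolutelyContinuous _ _ ?_
  rw [Measure.restrict_apply measurableSet_Icc.compl]
  convert measure_empty (μ := (volume : Measure ℝ))
  ext x
  simp only [Set.mem_inter_iff, Set.mem_compl_iff, Set.mem_Icc, Set.mem_Ioo,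
    Set.mem_empty_iff_false, iff_false]
  intro h
  exact h.1 ⟨h.2.1.le, h.2.2.le⟩

theorem IsChebProductMeasure.ae_mem_Icc {η : Measure (ℕ → ℝ)} (hη : IsChebProductMeasure η) :
    ∀ᵐ y ∂η, ∀ j, y j ∈ Set.Icc (-1 : ℝ) 1 := by
  rw [ae_all_iff]
  intro j
  have h := hη.2 {j} (fun _ => (Set.Icc (-1 : ℝ) 1)ᶜ) fun _ => measurableSet_Icc.compl
  rw [Finset.prod_singleton, chebMeasure_compl_Icc] at h
  rw [ae_iff]
  convert h using 2
  ext y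
  simp

theorem integral_cos_mul_arccos_chebMeasure [IsFiniteMeasure chebMeasure] {n : ℤ} (hn : n ≠ 0) :
    ∫ t, Real.cos (n * Real.arccos t) ∂chebMeasure = 0 := by
  have hmeas : Measurable fun t : ℝ => ENNReal.ofReal (1 / (Real.pi * Real.sqrt (1 - t ^ 2))) := by
    fun_prop
  have hfin : ∀ᵐ t ∂(volume.restrict (Set.Ioo (-1 : ℝ) 1)),
      ENNReal.ofReal (1 / (Real.pi * Real.sqrt (1 - t ^ 2))) < ⊤ :=
    Filter.Eventually.of_forall fun t => ENNReal.ofReal_lt_top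
  have hcos : Continuous fun t : ℝ => Real.cos (n * Real.arccos t) :=
    Real.continuous_cos.comp (continuous_const.mul Real.continuous_arccos)
  have hnn : ∀ t : ℝ, 0 ≤ 1 / (Real.pi * Real.sqrt (1 - t ^ 2)) := fun t =>
    one_div_nonneg.2 (mul_nonneg Real.pi_pos.le (Real.sqrt_nonneg _))
  have hint : Integrable (fun t : ℝ => Real.cos (n * Real.arccos t)) chebMeasure :=
    Integrable.of_bound hcos.aestronglyMeasurable 1
      (Filter.Eventually.of_forall fun t => Real.abs_cos_le_one _)
  rw [chebMeasure, integrable_withDensity_iff_integrable_smul' hmeas hfin] at hint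
  rw [chebMeasure, integral_withDensity_eq_integral_toReal_smul hmeas hfin]
  simp only [ENNReal.toReal_ofReal (hnn _), smul_eq_mul] at hint ⊢
  have hn' : (n : ℝ) ≠ 0 := Int.cast_ne_zero.2 hn
  have hFTC := intervalIntegral.integral_eq_sub_of_hasDerivAt_of_le (a := (-1 : ℝ)) (b := 1)
    (f := fun t => -(1 / (Real.pi * n)) * Real.sin (n * Real.arccos t))
    (f' := fun t => 1 / (Real.pi * Real.sqrt (1 - t ^ 2)) * Real.cos (n * Real.arccos t))
    (by norm_num)
    (continuous_const.mul (Real.continuous_sin.comp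
      (continuous_const.mul Real.continuous_arccos))).continuousOn ?_ ?_
  · rw [intervalIntegral.integral_of_le (by norm_num), integral_Ioc_eq_integral_Ioo] at hFTC
    rw [hFTC]
    simp [Real.sin_int_mul_pi]
  · intro t ht
    have h1 := ((Real.hasDerivAt_arccos ht.1.ne' ht.2.ne).const_mul (n : ℝ)).sin.const_mul
      (-(1 / (Real.pi * n)))
    refine h1.congr_deriv ?_
    have : Real.sqrt (1 - t ^ 2) ≠ 0 :=
      (Real.sqrt_pos.2 (by nlinarith [ht.1, ht.2])).ne'
    field_simp
  · rw [intervalIntegrable_iff_integrableOn_Ioo_of_le (by norm_num)]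
    exact hint

/-- The unnormalized tensorized Chebyshev polynomial, extended to integer multi-indices. -/
noncomputable def cosProd (z : ℕ →₀ ℤ) (y : ℕ → ℝ) : ℝ :=
  z.prod fun j n => Real.cos (n * Real.arccos (y j))

theorem continuous_cosProd (z : ℕ →₀ ℤ) : Continuous (cosProd z) := by
  unfold cosProd Finsupp.prod
  exact continuous_finsetProd _ fun j _ => Real.continuous_cos.comp
    (continuous_const.mul (Real.continuous_arccos.comp (continuous_apply j)))

theorem abs_cosProd_le_one (z : ℕ →₀ ℤ) (y : ℕ → ℝ) : |cosProd z y| ≤ 1 := by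
  unfold cosProd Finsupp.prod
  rw [Finset.abs_prod]
  exact Finset.prod_le_one (fun j _ => abs_nonneg _) fun j _ => Real.abs_cos_le_one _

theorem mul_cosProd (z : ℕ →₀ ℤ) (y : ℕ → ℝ) (j : ℕ) (hj : y j ∈ Set.Icc (-1 : ℝ) 1) :
    y j * cosProd z y =
      (cosProd (z + Finsupp.single j 1) y + cosProd (z - Finsupp.single j 1) y) / 2 := by
  have h0 : ∀ i, Real.cos (((0 : ℤ) : ℝ) * Real.arccos (y i)) = 1 := by simp
  have h := fun n : ℤ => Finsupp.prod_add_single_eq z j n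
    (fun i (n : ℤ) => Real.cos (n * Real.arccos (y i))) h0
  have hz := h 0
  rw [Finsupp.single_zero, add_zero, add_zero] at hz
  unfold cosProd
  rw [sub_eq_add_neg, ← Finsupp.single_neg, h 1, h (-1), hz]
  push_cast
  rw [add_mul, add_mul, Real.cos_add, Real.cos_add, one_mul, neg_one_mul, Real.cos_neg,
    Real.sin_neg, Real.cos_arccos hj.1 hj.2]
  ring

theorem integral_cosProd_eq_zero {η : Measure (ℕ → ℝ)} (hη : IsChebProductMeasure η)
    {z : ℕ →₀ ℤ} (hz : z ≠ 0) : ∫ y, cosProd z y ∂η = 0 := by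
  have := hη.isProbabilityMeasure_chebMeasure
  obtain ⟨j, hj⟩ := Finsupp.support_nonempty_iff.2 hz
  have hF : Continuous fun x : z.support → ℝ =>
      ∏ i : z.support, Real.cos (z i * Real.arccos (x i)) :=
    continuous_finsetProd _ fun i _ => Real.continuous_cos.comp
      (continuous_const.mul (Real.continuous_arccos.comp (continuous_apply i)))
  have hmap := integral_map (μ := η) (φ := (z.support.restrict : (ℕ → ℝ) → z.support → ℝ))
    (Finset.measurable_restrict _).aemeasurable hF.aestronglyMeasurable
  have hη' : η.map (z.support.restrict : (ℕ → ℝ) → z.support → ℝ) =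
      Measure.pi fun _ => chebMeasure := by
    rw [hη.eq_infinitePi, Measure.infinitePi_map_restrict]
  rw [hη', integral_fintype_prod_eq_prod
    (fun (i : z.support) (t : ℝ) => Real.cos (z i * Real.arccos t))] at hmap
  have hcos : ∀ y, cosProd z y =
      ∏ i : z.support, Real.cos (z i * Real.arccos (z.support.restrict y i)) := fun y =>
    (Finset.prod_coe_sort z.support fun i => Real.cos (z i * Real.arccos (y i))).symm
  simp only [hcos]
  rw [← hmap]
  exact Finset.prod_eq_zero (Finset.mem_univ ⟨j, hj⟩)
    (integral_cos_mul_arccos_chebMeasure (Finsupp.mem_support_iff.1 hj))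

theorem integrable_cosProd_smul {X : Type*} [NormedAddCommGroup X] [NormedSpace ℝ X]
    {η : Measure (ℕ → ℝ)} (hη : IsChebProductMeasure η) {u : (ℕ → ℝ) → X} {M : ℝ}
    (hu : AEStronglyMeasurable u η)
    (hM : ∀ y : ℕ → ℝ, (∀ j, y j ∈ Set.Icc (-1 : ℝ) 1) → ‖u y‖ ≤ M) (z : ℕ →₀ ℤ) :
    Integrable (fun y => cosProd z y • u y) η := by
  have := hη.1
  refine Integrable.of_bound ((continuous_cosProd z).aestronglyMeasurable.smul hu) M ?_
  filter_upwards [hη.ae_mem_Icc] with y hy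
  rw [norm_smul]
  exact (mul_le_of_le_one_left (norm_nonneg _) (abs_cosProd_le_one z y)).trans (hM y hy)

theorem norm_integral_cosProd_smul_le_of_bound {X : Type*} [NormedAddCommGroup X]
    [NormedSpace ℝ X] {η : Measure (ℕ → ℝ)} (hη : IsChebProductMeasure η) {u : (ℕ → ℝ) → X}
    {M : ℝ} (hM : ∀ y : ℕ → ℝ, (∀ j, y j ∈ Set.Icc (-1 : ℝ) 1) → ‖u y‖ ≤ M) (z : ℕ →₀ ℤ) :
    ‖∫ y, cosProd z y • u y ∂η‖ ≤ M := by
  have := hη.1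
  refine (norm_integral_le_of_norm_le_const (C := M) ?_).trans (by simp)
  filter_upwards [hη.ae_mem_Icc] with y hy
  rw [norm_smul]
  exact (mul_le_of_le_one_left (norm_nonneg _) (abs_cosProd_le_one z y)).trans (hM y hy)

/-- The Chebyshev coefficients of a solution of `u + ∑ⱼ yⱼ Bⱼ u = g` satisfy a nearest-neighbour
recursion. -/
theorem norm_integral_cosProd_smul_le {X : Type*} [NormedAddCommGroup X] [NormedSpace ℂ X]
    [CompleteSpace X] {η : Measure (ℕ → ℝ)} (hη : IsChebProductMeasure η) {u : (ℕ → ℝ) → X}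
    {M : ℝ} (hu : AEStronglyMeasurable u η)
    (hM : ∀ y : ℕ → ℝ, (∀ j, y j ∈ Set.Icc (-1 : ℝ) 1) → ‖u y‖ ≤ M)
    (B : ℕ → X →L[ℂ] X) (hB : Summable fun j => ‖B j‖) (g : X)
    (hsol : ∀ y : ℕ → ℝ, (∀ j, y j ∈ Set.Icc (-1 : ℝ) 1) →
      HasSum (fun j => y j • B j (u y)) (g - u y)) (z : ℕ →₀ ℤ) :
    ‖∫ y, cosProd z y • u y ∂η‖ ≤ (if z = 0 then ‖g‖ else 0) +
      ∑' j, ‖B j‖ / 2 * (‖∫ y, cosProd (z + Finsupp.single j 1) y • u y ∂η‖ +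
        ‖∫ y, cosProd (z - Finsupp.single j 1) y • u y ∂η‖) := by
  have := hη.1
  have hint := integrable_cosProd_smul hη hu hM
  have hM0 : 0 ≤ M :=
    (norm_nonneg _).trans (norm_integral_cosProd_smul_le_of_bound hη hM 0)
  let F : ℕ → (ℕ → ℝ) → X := fun j y => B j ((2⁻¹ : ℝ) •
    (cosProd (z + Finsupp.single j 1) y • u y + cosProd (z - Finsupp.single j 1) y • u y))
  have hpre : ∀ j, Integrable (fun y => (2⁻¹ : ℝ) •
      (cosProd (z + Finsupp.single j 1) y • u y + cosProd (z - Finsupp.single j 1) y • u y)) η :=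
    fun j => ((hint _).add (hint _)).smul _
  have hFint : ∀ j, Integrable (F j) η := fun j => (B j).integrable_comp (hpre j)
  have hFeq : ∀ j (y : ℕ → ℝ), (∀ j, y j ∈ Set.Icc (-1 : ℝ) 1) →
      F j y = cosProd z y • (y j • B j (u y)) := by
    intro j y hy
    have h : (2⁻¹ : ℝ) • (cosProd (z + Finsupp.single j 1) y • u y +
        cosProd (z - Finsupp.single j 1) y • u y) = (y j * cosProd z y) • u y := by
      rw [mul_cosProd z y j (hy j), ← add_smul, smul_smul]
      congr 1; ring
    simp only [F, h]
    rw [smul_smul, mul_comm, ← Complex.coe_smul, map_smul, Complex.coe_smul]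
  have hFnorm : ∀ j, ∫ y, ‖F j y‖ ∂η ≤ ‖B j‖ * M := by
    intro j
    have h1 : ∀ᵐ y ∂η, ‖F j y‖ ≤ ‖B j‖ * M := by
      filter_upwards [hη.ae_mem_Icc] with y hy
      rw [hFeq j y hy, norm_smul, norm_smul]
      have h2 : ‖y j‖ ≤ 1 := abs_le.2 (hy j)
      have h3 : ‖B j (u y)‖ ≤ ‖B j‖ * M :=
        ((B j).le_opNorm _).trans (mul_le_mul_of_nonneg_left (hM y hy) (norm_nonneg _))
      exact (mul_le_of_le_one_left (by positivity) (abs_cosProd_le_one z y)).trans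
        ((mul_le_of_le_one_left (norm_nonneg _) h2).trans h3)
    calc ∫ y, ‖F j y‖ ∂η ≤ ∫ _, ‖B j‖ * M ∂η :=
          integral_mono_ae (hFint j).norm (integrable_const _) h1
      _ = ‖B j‖ * M := by simp
  have hFsum : Summable fun j => ∫ y, ‖F j y‖ ∂η :=
    (hB.mul_right M).of_nonneg_of_le (fun j => integral_nonneg fun y => norm_nonneg _) hFnorm
  have hsum := hasSum_integral_of_summable_integral_norm hFint hFsum
  have hFval : ∀ j, ∫ y, F j y ∂η = B j ((2⁻¹ : ℝ) •
      ((∫ y, cosProd (z + Finsupp.single j 1) y • u y ∂η) +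
        ∫ y, cosProd (z - Finsupp.single j 1) y • u y ∂η)) := by
    intro j
    rw [(B j).integral_comp_comm (hpre j), integral_smul, integral_add (hint _) (hint _)]
  have hbound : ∀ j, ‖∫ y, F j y ∂η‖ ≤
      ‖B j‖ / 2 * (‖∫ y, cosProd (z + Finsupp.single j 1) y • u y ∂η‖ +
        ‖∫ y, cosProd (z - Finsupp.single j 1) y • u y ∂η‖) := by
    intro j
    rw [hFval]
    refine ((B j).le_opNorm _).trans ?_
    rw [norm_smul, Real.norm_of_nonneg (by norm_num : (0 : ℝ) ≤ 2⁻¹), div_eq_mul_inv, mul_assoc]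
    exact mul_le_mul_of_nonneg_left
      (mul_le_mul_of_nonneg_left (norm_add_le _ _) (by norm_num)) (norm_nonneg _)
  have hbsum : Summable fun j =>
      ‖B j‖ / 2 * (‖∫ y, cosProd (z + Finsupp.single j 1) y • u y ∂η‖ +
        ‖∫ y, cosProd (z - Finsupp.single j 1) y • u y ∂η‖) := by
    refine (hB.mul_right M).of_nonneg_of_le (fun j => by positivity) fun j => ?_
    have h1 := norm_integral_cosProd_smul_le_of_bound hη hM (z + Finsupp.single j 1)
    have h2 := norm_integral_cosProd_smul_le_of_bound hη hM (z - Finsupp.single j 1)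
    nlinarith [norm_nonneg (B j)]
  have hgint : Integrable (fun y => cosProd z y • g) η :=
    integrable_cosProd_smul hη (u := fun _ => g) aestronglyMeasurable_const
      (fun _ _ => le_rfl) z
  have hae : ∀ᵐ y ∂η, ∑' j, F j y = cosProd z y • g - cosProd z y • u y := by
    filter_upwards [hη.ae_mem_Icc] with y hy
    rw [tsum_congr fun j => hFeq j y hy, ((hsol y hy).const_smul (cosProd z y)).tsum_eq, smul_sub]
  rw [integral_congr_ae hae, integral_sub hgint (hint z)] at hsum
  have hD : ∫ y, cosProd z y • u y ∂η =
      (∫ y, cosProd z y • g ∂η) - ∑' j, ∫ y, F j y ∂η := by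
    rw [hsum.tsum_eq, sub_sub_cancel]
  rw [hD]
  refine (norm_sub_le _ _).trans (add_le_add ?_ (tsum_of_norm_bounded hbsum.hasSum hbound))
  split_ifs with hz
  · exact norm_integral_cosProd_smul_le_of_bound hη (u := fun _ => g) (fun _ _ => le_rfl) z
  · rw [integral_smul_const, integral_cosProd_eq_zero hη hz, zero_smul, norm_zero]

/-- Solutions of `u + ∑ⱼ yⱼ Bⱼ u = g` on the parameter cube are strongly measurable. -/
theorem aestronglyMeasurable_of_hasSum {X : Type*} [NormedAddCommGroup X] [NormedSpace ℂ X]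
    [CompleteSpace X] {η : Measure (ℕ → ℝ)} (hη : IsChebProductMeasure η) {u : (ℕ → ℝ) → X}
    (B : ℕ → X →L[ℂ] X) (hB : Summable fun j => ‖B j‖) (hB1 : ∑' j, ‖B j‖ < 1) (g : X)
    (hsol : ∀ y : ℕ → ℝ, (∀ j, y j ∈ Set.Icc (-1 : ℝ) 1) →
      HasSum (fun j => y j • B j (u y)) (g - u y)) :
    AEStronglyMeasurable u η := by
  let c : ℝ → ℝ := fun t => max (-1) (min 1 t)
  have hc : Continuous c := by fun_prop
  have hc1 : ∀ t, |c t| ≤ 1 := fun t =>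
    abs_le.2 ⟨le_max_left _ _, max_le (by norm_num) (min_le_left _ _)⟩
  have hcid : ∀ t ∈ Set.Icc (-1 : ℝ) 1, c t = t := fun t ht => by
    simp only [c]; rw [min_eq_right ht.2, max_eq_right ht.1]
  let T : (ℕ → ℝ) → X →L[ℂ] X := fun y => ∑' j, ((-c (y j) : ℝ) : ℂ) • B j
  have hterm : ∀ j (y : ℕ → ℝ), ‖((-c (y j) : ℝ) : ℂ) • B j‖ ≤ ‖B j‖ := fun j y => by
    rw [norm_smul, Complex.norm_real, Real.norm_eq_abs, abs_neg]
    exact mul_le_of_le_one_left (norm_nonneg _) (hc1 _)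
  have hTcont : Continuous T := by
    refine continuous_tsum (fun j => ?_) hB hterm
    exact (Complex.continuous_ofReal.comp (hc.comp (continuous_apply j)).neg).smul
      continuous_const
  have hTsum : ∀ y : ℕ → ℝ, Summable fun j => ((-c (y j) : ℝ) : ℂ) • B j := fun y =>
    Summable.of_norm_bounded hB (hterm · y)
  have hT1 : ∀ y, ‖T y‖ < 1 := fun y =>
    (tsum_of_norm_bounded hB.hasSum (hterm · y)).trans_lt hB1
  have hcont : Continuous fun y => Ring.inverse (1 - T y) g := by
    have : Continuous fun y => Ring.inverse (1 - T y) := by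
      refine continuous_iff_continuousAt.2 fun y => ?_
      have h := NormedRing.inverse_continuousAt (Units.oneSub (T y) (hT1 y))
      exact ContinuousAt.comp (f := fun y => 1 - T y) h
        (continuous_const.sub hTcont).continuousAt
    exact this.clm_apply continuous_const
  refine hcont.aestronglyMeasurable.congr ?_
  filter_upwards [hη.ae_mem_Icc] with y hy
  have h1 : (1 - T y) (u y) = g := by
    have h2 : HasSum (fun j => (((-c (y j) : ℝ) : ℂ) • B j) (u y)) (T y (u y)) :=
      (hTsum y).hasSum.mapL (ContinuousLinearMap.apply ℂ X (u y))
    have h3 : HasSum (fun j => (((-c (y j) : ℝ) : ℂ) • B j) (u y)) (-(g - u y)) := by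
      refine ((hsol y hy).neg).congr_fun ?_
      intro j
      rw [hcid _ (hy j), smul_apply, Complex.coe_smul, neg_smul]
    rw [sub_apply, one_apply_eq_self, h2.unique h3]
    abel
  have hunit : IsUnit (1 - T y) := (Units.oneSub (T y) (hT1 y)).isUnit
  rw [← h1, ← mul_apply_eq_comp,
    Ring.inverse_mul_cancel _ hunit,
    one_apply_eq_self]

/-- weighted `ℓ_p` summability of Chebyshev coefficients. Under the weighted
smallness condition `∑ⱼ β_{0,j} vⱼ^{(2-p)/p} ≤ κ < 1` and `∑ⱼ β_{0,j}^p vⱼ^{2-p} < ∞`, the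
tensorized Chebyshev coefficients `d_ν = ∫ u(y) T_ν(y) dη(y)` of the parametric solution
satisfy `∑_ν ω_ν^{2-p} ‖d_ν‖^p < ∞` with `ω_ν = θ^{‖ν‖₀} ∏_{j ∈ supp ν} vⱼ^{νⱼ}`. -/
theorem stmt10 (p : ℝ) (hp0 : 0 < p) (hp1 : p ≤ 1)
    {X Y : Type*} [NormedAddCommGroup X] [NormedSpace ℂ X] [CompleteSpace X]
    [NormedAddCommGroup Y] [NormedSpace ℂ Y] [CompleteSpace Y]
    (A0 : X →L[ℂ] Y) (A0inv : Y →L[ℂ] X)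
    (hleft : ∀ x, A0inv (A0 x) = x) (hright : ∀ w, A0 (A0inv w) = w)
    (μ0 : ℝ) (hμ0 : 0 < μ0) (hA0inv : ‖A0inv‖ ≤ 1 / μ0)
    (A : ℕ → X →L[ℂ] Y)
    (v : ℕ → ℝ) (hv : ∀ j, 1 ≤ v j) (κ : ℝ) (hκ : κ < 1)
    (hsum : Summable fun j => ‖A0inv.comp (A j)‖ * v j ^ ((2 - p) / p))
    (hwsmall : (∑' j, ‖A0inv.comp (A j)‖ * v j ^ ((2 - p) / p)) ≤ κ)
    (hwlp : Summable fun j => ‖A0inv.comp (A j)‖ ^ p * v j ^ (2 - p))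
    (η : Measure (ℕ → ℝ)) (hη : IsChebProductMeasure η)
    (f : Y) (u : (ℕ → ℝ) → X)
    (hu : ∀ y : ℕ → ℝ, (∀ j, y j ∈ Set.Icc (-1 : ℝ) 1) →
      ∃ S : X →L[ℂ] Y, HasSum (fun j => (y j : ℂ) • A j) S ∧ (A0 + S) (u y) = f)
    (θ : ℝ) (hθ : 1 ≤ θ) :
    Summable (fun ν : ℕ →₀ ℕ =>
      (θ ^ ν.support.card * ∏ j ∈ ν.support, v j ^ ν j) ^ (2 - p) *
        ‖∫ y, chebProd ν y • u y ∂η‖ ^ p) := by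
  set B : ℕ → X →L[ℂ] X := fun j => A0inv.comp (A j) with hBdef
  set w : ℝ := (2 - p) / p with hw
  have hw0 : 0 ≤ w := div_nonneg (by linarith) hp0.le
  have hwp : w * p = 2 - p := div_mul_cancel₀ _ hp0.ne'
  have hv0 : ∀ j, 0 ≤ v j := fun j => zero_le_one.trans (hv j)
  have hV1 : ∀ j, 1 ≤ v j ^ w := fun j => Real.one_le_rpow (hv j) hw0
  have hlt : ∑' j, ‖B j‖ * v j ^ w < 1 := hwsmall.trans_lt hκ
  have hle : ∀ j, ‖B j‖ ≤ ‖B j‖ * v j ^ w := fun j =>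
    le_mul_of_one_le_right (norm_nonneg _) (hV1 j)
  have hBs : Summable fun j => ‖B j‖ := hsum.of_nonneg_of_le (fun j => norm_nonneg _) hle
  have hB1 : ∑' j, ‖B j‖ < 1 := (hBs.tsum_le_tsum hle hsum).trans_lt hlt
  have hsol : ∀ y : ℕ → ℝ, (∀ j, y j ∈ Set.Icc (-1 : ℝ) 1) →
      HasSum (fun j => y j • B j (u y)) (A0inv f - u y) := by
    intro y hy
    obtain ⟨S, hS, hSu⟩ := hu y hy
    have h1 := (hS.mapL (ContinuousLinearMap.apply ℂ Y (u y))).mapL A0inv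
    have h2 : A0inv (S (u y)) = A0inv f - u y := by
      rw [← hSu, add_apply, map_add, hleft, add_sub_cancel_left]
    rw [← h2]
    refine h1.congr_fun fun j => ?_
    simp [hBdef]
  have hM : ∀ y : ℕ → ℝ, (∀ j, y j ∈ Set.Icc (-1 : ℝ) 1) →
      ‖u y‖ ≤ ‖A0inv f‖ / (1 - ∑' j, ‖B j‖) := by
    intro y hy
    rw [le_div_iff₀ (by linarith)]
    have h1 : ‖A0inv f - u y‖ ≤ (∑' j, ‖B j‖) * ‖u y‖ := by
      rw [← (hsol y hy).tsum_eq]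
      refine tsum_of_norm_bounded (hBs.hasSum.mul_right _) fun j => ?_
      rw [norm_smul]
      exact (mul_le_of_le_one_left (norm_nonneg _) (abs_le.2 (hy j))).trans ((B j).le_opNorm _)
    have h2 : ‖u y‖ ≤ ‖A0inv f‖ + ‖A0inv f - u y‖ := by
      simpa using norm_sub_le (A0inv f) (A0inv f - u y)
    linarith
  have hmeas := aestronglyMeasurable_of_hasSum hη B hBs hB1 _ hsol
  have hrec := norm_integral_cosProd_smul_le hη hmeas hM B hBs _ hsol
  let emb : (ℕ →₀ ℕ) → (ℕ →₀ ℤ) := Finsupp.mapRange Nat.cast Nat.cast_zero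
  have hemb : Function.Injective emb :=
    Finsupp.mapRange_injective _ Nat.cast_zero Nat.cast_injective
  have hembprod : ∀ {h : ℕ → ℤ → ℝ}, (∀ j, h j 0 = 1) → ∀ ν : ℕ →₀ ℕ,
      (emb ν).prod h = ∏ j ∈ ν.support, h j (ν j) := fun h0 ν =>
    Finsupp.prod_mapRange_index h0
  have hcheb : ∀ (ν : ℕ →₀ ℕ) y,
      chebProd ν y = Real.sqrt 2 ^ ν.support.card * cosProd (emb ν) y := by
    intro ν y
    unfold chebProd cosProd
    rw [hembprod (by simp), ← Finset.prod_const, ← Finset.prod_mul_distrib]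
    refine Finset.prod_congr rfl fun j hj => ?_
    rw [chebFun, if_neg (Finsupp.mem_support_iff.1 hj), Int.cast_natCast]
  have hK : 1 ≤ Real.sqrt 2 * θ ^ w :=
    one_le_mul_of_one_le_of_one_le (Real.one_le_sqrt.2 one_le_two) (Real.one_le_rpow hθ hw0)
  have hwlp' : Summable fun j => (‖B j‖ * v j ^ w) ^ p := by
    refine hwlp.congr fun j => ?_
    rw [Real.mul_rpow (norm_nonneg _) (Real.rpow_nonneg (hv0 j) _), ← Real.rpow_mul (hv0 j), hwp]
  have key := summable_rpow_of_forall_weight p hp0 hp1 (fun j => ‖B j‖) (fun j => v j ^ w)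
    (Real.sqrt 2 * θ ^ w) (fun j => norm_nonneg _) hV1 hK hsum hlt hwlp'
    (fun ν => ‖∫ y, cosProd (emb ν) y • u y ∂η‖) (fun ν => norm_nonneg _) ?_
  · refine key.congr fun ν => ?_
    have hθ0 : 0 ≤ θ := zero_le_one.trans hθ
    have hint : ‖∫ y, chebProd ν y • u y ∂η‖ =
        Real.sqrt 2 ^ ν.support.card * ‖∫ y, cosProd (emb ν) y • u y ∂η‖ := by
      simp only [hcheb, mul_smul]
      rw [integral_smul, norm_smul, Real.norm_of_nonneg (by positivity)]
    have hP : 0 ≤ ∏ j ∈ ν.support, v j ^ ν j :=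
      Finset.prod_nonneg fun j _ => pow_nonneg (hv0 j) _
    have hweight : (θ ^ ν.support.card * ∏ j ∈ ν.support, v j ^ ν j) ^ w =
        (θ ^ w) ^ ν.support.card * ∏ j ∈ ν.support, (v j ^ w) ^ ν j := by
      rw [Real.mul_rpow (pow_nonneg hθ0 _) hP, ← Real.rpow_pow_comm hθ0,
        ← Real.finsetProd_rpow _ _ fun j _ => pow_nonneg (hv0 j) _]
      congr 1
      exact Finset.prod_congr rfl fun j _ => (Real.rpow_pow_comm (hv0 j) _ _).symm
    have hW : 0 ≤ θ ^ ν.support.card * ∏ j ∈ ν.support, v j ^ ν j :=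
      mul_nonneg (pow_nonneg hθ0 _) hP
    rw [hint, ← hwp, Real.rpow_mul hW, ← Real.mul_rpow (Real.rpow_nonneg hW _) (by positivity),
      hweight, mul_pow]
    congr 1
    ring
  · intro r hr hrs hr1
    have h := summable_weight_mul_of_lattice_recursion
      (fun z => ‖∫ y, cosProd z y • u y ∂η‖) _ ‖A0inv f‖ (fun j => ‖B j‖) r
      (fun z => norm_nonneg _) (norm_integral_cosProd_smul_le_of_bound hη hM) (norm_nonneg _)
      (fun j => norm_nonneg _) hr hrs hr1 hrec
    refine (h.comp_injective hemb).congr fun ν => ?_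
    simp only [Function.comp_apply]
    rw [hembprod (by simp)]
    simp only [Int.natAbs_natCast]
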